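/- Let n ≥ 1, s ∈ (1/2,1), 0 ≤ R₀ < R, Ω = A_{R₀,R}, ℓ ∈ (2, 2_s^*), and let f̃ : ℝ → ℝ be continuously differentiable on [0,∞), identically 0 on (−∞,0), non-negative, with lim_{t→∞} f̃(t)/t^{ℓ−1} = 1 and f̃(t) ≤ C₀(1 + t^{ℓ−1}) for all t ≥ 0 and some C₀ > 0. Let 0 ≤ u_− < u_+ be real numbers and set 𝒞_* := {u ∈ 𝒞₊(Ω) : u_− ≤ u ≤ u_+ a.e. in Ω}. Let c ∈ ℝ be such that for every u ∈ 𝒞_* with E(u) = c there exists v ∈ H^s_{Ω,0} with E'(u)[v] ≠ 0. Then there exist ε̄ > 0 and δ̄ > 0 such that ‖E'(u)‖_* ≥ δ̄ for every u ∈ 𝒞_* with |E(u) − c| ≤ 2ε̄. -/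

import Mathlib

open MeasureTheory Filter Set

noncomputable section

/-- Euclidean space ℝⁿ. -/
abbrev En (n : ℕ) : Type := EuclideanSpace ℝ (Fin n)

/-- The annulus `A_{R₀,R} = {x : R₀ < |x| < R}`, understood as the ball `B_R` when `R₀ = 0`. -/
def annR (n : ℕ) (R₀ R : ℝ) : Set (En n) :=
  if R₀ = 0 then Metric.ball (0 : En n) R else {x : En n | R₀ < ‖x‖ ∧ ‖x‖ < R}

/-- The region `ℝ^{2n} ∖ (Ωᶜ × Ωᶜ)`: pairs (x,y) not both outside Ω. -/
def crossSet {n : ℕ} (Ω : Set (En n)) : Set (En n × En n) :=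
  {p : En n × En n | p.1 ∈ Ω ∨ p.2 ∈ Ω}

/-- Gagliardo integrand `|u(x) - u(y)|² / |x-y|^{n+2s}`. -/
def gagSq {n : ℕ} (s : ℝ) (u : En n → ℝ) (p : En n × En n) : ℝ :=
  |u p.1 - u p.2| ^ 2 / dist p.1 p.2 ^ ((n : ℝ) + 2 * s)

/-- Bilinear Gagliardo integrand `(u(x)-u(y))(v(x)-v(y)) / |x-y|^{n+2s}`. -/
def gagBil {n : ℕ} (s : ℝ) (u v : En n → ℝ) (p : En n × En n) : ℝ :=
  (u p.1 - u p.2) * (v p.1 - v p.2) / dist p.1 p.2 ^ ((n : ℝ) + 2 * s)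

/-- Membership in `H^s_{Ω,0}`. -/
def MemHs {n : ℕ} (s : ℝ) (Ω : Set (En n)) (u : En n → ℝ) : Prop :=
  Measurable u ∧ IntegrableOn (fun x => (u x) ^ 2) Ω ∧
    IntegrableOn (gagSq s u) (crossSet Ω)

/-- Square of the seminorm `[u]_{H^s_{Ω,0}}²`. -/
def seminormSq {n : ℕ} (c s : ℝ) (Ω : Set (En n)) (u : En n → ℝ) : ℝ :=
  (c / 2) * ∫ p in crossSet Ω, gagSq s u p

/-- The norm `‖u‖_{H^s_{Ω,0}} = ‖u‖_{L²(Ω)} + [u]_{H^s_{Ω,0}}`. -/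
def HsNorm {n : ℕ} (c s : ℝ) (Ω : Set (En n)) (u : En n → ℝ) : ℝ :=
  (∫ x in Ω, (u x) ^ 2) ^ (1/2 : ℝ) + (seminormSq c s Ω u) ^ (1/2 : ℝ)

/-- `u ∈ H^s_{Ω,0}` is a weak solution of the linear Neumann problem
`(-Δ)ˢ u + u = h` in Ω, `𝒩ₛ u = 0` outside. -/
def SolvesLin {n : ℕ} (c s : ℝ) (Ω : Set (En n)) (h u : En n → ℝ) : Prop :=
  MemHs s Ω u ∧ ∀ v : En n → ℝ, MemHs s Ω v →
    IntegrableOn (gagBil s u v) (crossSet Ω) ∧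
    IntegrableOn (fun x => u x * v x) Ω ∧
    IntegrableOn (fun x => h x * v x) Ω ∧
    (c / 2) * (∫ p in crossSet Ω, gagBil s u v p) + ∫ x in Ω, u x * v x
      = ∫ x in Ω, h x * v x

/-- Weak solution of the nonlinear Neumann problem `(-Δ)ˢ u + u = g(u)`, `u ≥ 0`. -/
def IsWeakSolution {n : ℕ} (c s : ℝ) (Ω : Set (En n)) (g : ℝ → ℝ) (u : En n → ℝ) : Prop :=
  (∀ᵐ x ∂(volume.restrict Ω), 0 ≤ u x) ∧ SolvesLin c s Ω (fun x => g (u x)) u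

/-- `u` is radial with profile `φ`. -/
def IsRadialWith {n : ℕ} (u : En n → ℝ) (φ : ℝ → ℝ) : Prop :=
  ∀ x : En n, u x = φ ‖x‖

/-- The cone `𝒞₊` of non-negative, radial, radially non-decreasing functions in `H^s_{Ω,0}`. -/
def InConePlus {n : ℕ} (s R₀ R : ℝ) (Ω : Set (En n)) (u : En n → ℝ) : Prop :=
  MemHs s Ω u ∧ (∀ x, 0 ≤ u x) ∧
    ∃ φ : ℝ → ℝ, IsRadialWith u φ ∧ MonotoneOn φ (Icc R₀ R)

/-- The cone `𝒞₋` of non-negative, radial, radially non-increasing functions in `H^s_{Ω,0}`. -/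
def InConeMinus {n : ℕ} (s R₀ R : ℝ) (Ω : Set (En n)) (u : En n → ℝ) : Prop :=
  MemHs s Ω u ∧ (∀ x, 0 ≤ u x) ∧
    ∃ φ : ℝ → ℝ, IsRadialWith u φ ∧ AntitoneOn φ (Icc R₀ R)

/-- The second radial increasing eigenvalue `λ₂^{+,r}(Ω)`. -/
def lambda2plusr {n : ℕ} (c s R₀ R : ℝ) (Ω : Set (En n)) : ℝ :=
  sInf { t : ℝ | ∃ (v : En n → ℝ) (φ : ℝ → ℝ), MemHs s Ω v ∧ IsRadialWith v φ ∧
    MonotoneOn φ (Icc R₀ R) ∧ (∫ x in Ω, v x) = 0 ∧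
    ¬ (∀ᵐ x ∂(volume.restrict Ω), v x = 0) ∧
    t = seminormSq c s Ω v / ∫ x in Ω, (v x) ^ 2 }

/-- The second radial eigenvalue `λ₂^{rad}(Ω)`. -/
def lambda2rad {n : ℕ} (c s : ℝ) (Ω : Set (En n)) : ℝ :=
  sInf { t : ℝ | ∃ (v : En n → ℝ) (φ : ℝ → ℝ), MemHs s Ω v ∧ IsRadialWith v φ ∧
    (∫ x in Ω, v x) = 0 ∧ ¬ (∀ᵐ x ∂(volume.restrict Ω), v x = 0) ∧
    t = seminormSq c s Ω v / ∫ x in Ω, (v x) ^ 2 }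

/-- The energy functional associated with the truncated problem, with `F̃(t) = ∫₀ᵗ f̃`. -/
def energy {n : ℕ} (c s : ℝ) (Ω : Set (En n)) (ftil : ℝ → ℝ) (u : En n → ℝ) : ℝ :=
  (c / 4) * (∫ p in crossSet Ω, gagSq s u p) + (1/2) * (∫ x in Ω, (u x) ^ 2)
    - ∫ x in Ω, (∫ τ in (0:ℝ)..(u x), ftil τ)

/-- The derivative of the energy functional: `E'(u)[v]`. -/
def Eprime {n : ℕ} (c s : ℝ) (Ω : Set (En n)) (ftil : ℝ → ℝ) (u v : En n → ℝ) : ℝ :=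
  (c / 2) * (∫ p in crossSet Ω, gagBil s u v p) + (∫ x in Ω, u x * v x)
    - ∫ x in Ω, ftil (u x) * v x


open scoped Topology

/-! ### Sequential compactness of bounded monotone functions -/

/-- Helly selection, almost everywhere version: a sequence of monotone functions with values in
`[0, M]` has a subsequence converging off a countable set. -/
theorem exists_subseq_tendsto_of_monotone {M : ℝ} (ψ : ℕ → ℝ → ℝ) (hmono : ∀ k, Monotone (ψ k))
    (hmem : ∀ k r, ψ k r ∈ Icc 0 M) :
    ∃ σ : ℕ → ℕ, StrictMono σ ∧ ∃ C : Set ℝ, C.Countable ∧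
      ∀ r ∉ C, ∃ L, Tendsto (fun k => ψ (σ k) r) atTop (𝓝 L) := by
  obtain ⟨g, σ, hσ, hg⟩ := CompactSpace.tendsto_subseq
    (fun k (q : ℚ) => (⟨ψ k q, hmem k q⟩ : Icc (0 : ℝ) M))
  have hgq : ∀ q : ℚ, Tendsto (fun k => ψ (σ k) q) atTop (𝓝 (g q : ℝ)) := fun q =>
    (continuous_subtype_val.tendsto _).comp ((tendsto_pi_nhds.1 hg) q)
  have hgmono : ∀ p q : ℚ, p ≤ q → (g p : ℝ) ≤ g q := fun p q hpq =>
    le_of_tendsto_of_tendsto' (hgq p) (hgq q) fun k => hmono _ (by exact_mod_cast hpq)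
  let G : ℝ → ℝ := fun x => sSup ((fun q : ℚ => (g q : ℝ)) '' {q | (q : ℝ) < x})
  have hbdd : ∀ x, BddAbove ((fun q : ℚ => (g q : ℝ)) '' {q | (q : ℝ) < x}) := by
    rintro x
    refine ⟨M, ?_⟩
    rintro _ ⟨q, -, rfl⟩
    exact (g q).2.2
  have hne : ∀ x : ℝ, ((fun q : ℚ => (g q : ℝ)) '' {q | (q : ℝ) < x}).Nonempty := fun x =>
    let ⟨q, hq⟩ := exists_rat_lt x
    ⟨_, q, hq, rfl⟩
  have hG : Monotone G := fun x y hxy =>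
    csSup_le_csSup (hbdd y) (hne x) (image_mono fun q (hq : (q : ℝ) < x) => hq.trans_le hxy)
  refine ⟨σ, hσ, {x | ¬ ContinuousAt G x}, hG.countable_not_continuousAt, fun x hx => ⟨G x, ?_⟩⟩
  have hx : ContinuousAt G x := not_not.1 hx
  refine tendsto_order.2 ⟨fun a ha => ?_, fun a ha => ?_⟩
  · obtain ⟨_, ⟨q, hq, rfl⟩, haq⟩ := exists_lt_of_lt_csSup (hne x) ha
    filter_upwards [(hgq q).eventually_const_lt haq] with k hk
    exact hk.trans_le (hmono _ (le_of_lt hq))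
  · have h1 : ∀ᶠ y in 𝓝[>] x, G y < a :=
      (hx.eventually_lt continuousAt_const ha).filter_mono nhdsWithin_le_nhds
    obtain ⟨y, hya, hxy⟩ := (h1.and self_mem_nhdsWithin).exists
    obtain ⟨q, hxq, hqy⟩ := exists_rat_btwn (show x < y from hxy)
    have hqG : (g q : ℝ) ≤ G y := le_csSup (hbdd y) ⟨q, hqy, rfl⟩
    filter_upwards [(hgq q).eventually_lt_const (hqG.trans_lt hya)] with k hk
    exact (hmono _ hxq.le).trans_lt hk

/-! ### Square-integrable functions -/

section L2

variable {α : Type*} [MeasurableSpace α] {μ : Measure α}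

theorem inner_toLp_eq_integral {f g : α → ℝ} (hf : MemLp f 2 μ) (hg : MemLp g 2 μ) :
    inner ℝ (hf.toLp f) (hg.toLp g) = ∫ x, f x * g x ∂μ := by
  rw [L2.inner_def]
  refine integral_congr_ae ?_
  filter_upwards [hf.coeFn_toLp, hg.coeFn_toLp] with x h1 h2
  simp [h1, h2, mul_comm]

theorem norm_toLp_sq_eq_integral {f : α → ℝ} (hf : MemLp f 2 μ) :
    ‖hf.toLp f‖ ^ 2 = ∫ x, f x ^ 2 ∂μ := by
  rw [← real_inner_self_eq_norm_sq, inner_toLp_eq_integral]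
  simp_rw [sq]

theorem memLp_comp_of_mem_Icc [IsFiniteMeasure μ] {G : ℝ → ℝ} (hG : Continuous G) {M : ℝ}
    {f : α → ℝ} (hf : Measurable f) (hfM : ∀ᵐ x ∂μ, f x ∈ Icc 0 M) :
    MemLp (fun x => G (f x)) 2 μ := by
  obtain ⟨B, hB⟩ := isCompact_Icc.exists_bound_of_continuousOn hG.continuousOn
  exact MemLp.of_bound (hG.measurable.comp hf).aestronglyMeasurable B
    (hfM.mono fun x hx => hB _ hx)

theorem tendsto_integral_comp_of_mem_Icc [IsFiniteMeasure μ] {G : ℝ → ℝ} (hG : Continuous G)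
    {M : ℝ} {f : ℕ → α → ℝ} {f' : α → ℝ} (hf : ∀ k, Measurable (f k))
    (hfM : ∀ k, ∀ᵐ x ∂μ, f k x ∈ Icc 0 M)
    (hlim : ∀ᵐ x ∂μ, Tendsto (fun k => f k x) atTop (𝓝 (f' x))) :
    Tendsto (fun k => ∫ x, G (f k x) ∂μ) atTop (𝓝 (∫ x, G (f' x) ∂μ)) := by
  obtain ⟨B, hB⟩ := isCompact_Icc.exists_bound_of_continuousOn hG.continuousOn
  exact tendsto_integral_of_dominated_convergence (fun _ => B)
    (fun k => (hG.measurable.comp (hf k)).aestronglyMeasurable) (integrable_const B)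
    (fun k => (hfM k).mono fun x hx => hB _ hx)
    (hlim.mono fun x hx => (hG.tendsto _).comp hx)

theorem tendsto_toLp_comp_of_mem_Icc [IsFiniteMeasure μ] {G : ℝ → ℝ} (hG : Continuous G)
    {M : ℝ} {f : ℕ → α → ℝ} {f' : α → ℝ}
    (hfM : ∀ k, ∀ᵐ x ∂μ, f k x ∈ Icc 0 M)
    (hlim : ∀ᵐ x ∂μ, Tendsto (fun k => f k x) atTop (𝓝 (f' x)))
    (hGf : ∀ k, MemLp (fun x => G (f k x)) 2 μ) (hGf' : MemLp (fun x => G (f' x)) 2 μ) :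
    Tendsto (fun k => (hGf k).toLp _) atTop (𝓝 (hGf'.toLp _)) := by
  obtain ⟨B, hB⟩ := isCompact_Icc.exists_bound_of_continuousOn hG.continuousOn
  rw [tendsto_iff_norm_sub_tendsto_zero]
  have hsq : Tendsto (fun k => ‖(hGf k).toLp _ - hGf'.toLp _‖ ^ 2) atTop (𝓝 0) := by
    simp_rw [← MemLp.toLp_sub, norm_toLp_sq_eq_integral]
    have h0 : ∫ x, (0 : ℝ) ∂μ = 0 := by simp
    rw [← h0]
    have hB' : ∀ᵐ x ∂μ, ‖G (f' x)‖ ≤ B := by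
      filter_upwards [hlim, ae_all_iff.2 hfM] with x hx hM
      exact hB _ (isClosed_Icc.mem_of_tendsto hx (Eventually.of_forall hM))
    refine tendsto_integral_of_dominated_convergence (fun _ => (B + B) ^ 2)
      (fun k => (((hGf k).sub hGf').aestronglyMeasurable).pow 2) (integrable_const _)
      (fun k => ?_) ?_
    · filter_upwards [hfM k, hB'] with x hx hx'
      rw [norm_pow]
      exact pow_le_pow_left₀ (norm_nonneg _)
        ((norm_sub_le _ _).trans (add_le_add (hB _ hx) hx')) 2
    · filter_upwards [hlim] with x hx
      have := (((hG.tendsto _).comp hx).sub_const (G (f' x))).pow 2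
      simpa using this
  simpa using hsq.sqrt

end L2

/-- A sequence whose increments `y` satisfy `y² ≤ (η + η')(1 + a + y) + b·a`, where `η, η' → 0` and
`a`, `b` are increments of convergent sequences, is Cauchy. -/
theorem cauchySeq_of_sq_norm_sub_le {H K : Type*} [NormedAddCommGroup H] [NormedAddCommGroup K]
    {w : ℕ → H} {a h : ℕ → K} {η : ℕ → ℝ} (ha : CauchySeq a) (hh : CauchySeq h)
    (hη : Tendsto η atTop (𝓝 0)) {b : ℝ} (hb : 0 < b)
    (hle : ∀ k m, (b * ‖w k - w m‖) ^ 2 ≤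
      (η k + η m) * (1 + ‖a k - a m‖ + b * ‖w k - w m‖) + ‖h k - h m‖ * ‖a k - a m‖) :
    CauchySeq w := by
  rw [cauchySeq_iff_tendsto_dist_atTop_0] at *
  simp only [dist_eq_norm] at *
  have hη2 : Tendsto (fun p : ℕ × ℕ => η p.1 + η p.2) atTop (𝓝 0) := by
    rw [← prod_atTop_atTop_eq]
    simpa using (hη.comp tendsto_fst).add (hη.comp tendsto_snd)
  have hbound : Tendsto (fun p : ℕ × ℕ => Real.sqrt (2 * (η p.1 + η p.2) * (1 + ‖a p.1 - a p.2‖)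
      + 2 * (‖h p.1 - h p.2‖ * ‖a p.1 - a p.2‖) + (η p.1 + η p.2) ^ 2) / b) atTop (𝓝 0) := by
    have := (((((hη2.const_mul 2).mul (ha.const_add 1)).add ((hh.mul ha).const_mul 2)).add
      (hη2.pow 2)).sqrt).div_const b
    simpa using this
  refine squeeze_zero (fun p => norm_nonneg _) (fun p => ?_) hbound
  rw [le_div_iff₀ hb, mul_comm]
  refine Real.le_sqrt_of_sq_le ?_
  nlinarith [hle p.1 p.2, sq_nonneg (b * ‖w p.1 - w p.2‖ - (η p.1 + η p.2))]

/-! ### The space `H^s_{Ω,0}` -/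

section FractionalSpace

variable {n : ℕ} {s c : ℝ} {Ω : Set (En n)} {u v : En n → ℝ}

/-- The fractional difference quotient `(u(x) - u(y)) / |x - y|^{(n+2s)/2}`. -/
def diffQuot (s : ℝ) (u : En n → ℝ) (p : En n × En n) : ℝ :=
  (u p.1 - u p.2) / dist p.1 p.2 ^ (((n : ℝ) + 2 * s) / 2)

theorem gagBil_eq_diffQuot_mul (s : ℝ) (u v : En n → ℝ) (p : En n × En n) :
    gagBil s u v p = diffQuot s u p * diffQuot s v p := by
  have h : dist p.1 p.2 ^ ((n : ℝ) + 2 * s)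
      = dist p.1 p.2 ^ (((n : ℝ) + 2 * s) / 2) * dist p.1 p.2 ^ (((n : ℝ) + 2 * s) / 2) := by
    rw [← sq, ← Real.rpow_natCast, ← Real.rpow_mul dist_nonneg]
    norm_num
  rw [gagBil, diffQuot, diffQuot, h, mul_div_mul_comm]

theorem gagSq_eq_diffQuot_sq (s : ℝ) (u : En n → ℝ) (p : En n × En n) :
    gagSq s u p = diffQuot s u p ^ 2 := by
  rw [sq, ← gagBil_eq_diffQuot_mul, gagSq, gagBil, sq_abs, sq]

theorem diffQuot_sub (s : ℝ) (u v : En n → ℝ) :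
    diffQuot s (u - v) = diffQuot s u - diffQuot s v := by
  ext p
  simp only [diffQuot, Pi.sub_apply]
  ring

theorem diffQuot_smul (s t : ℝ) (u : En n → ℝ) : diffQuot s (t • u) = t • diffQuot s u := by
  ext p
  simp only [diffQuot, Pi.smul_apply, smul_eq_mul]
  ring

theorem measurable_diffQuot (s : ℝ) (hu : Measurable u) : Measurable (diffQuot s u) := by
  unfold diffQuot
  fun_prop

theorem memHs_iff : MemHs s Ω u ↔ Measurable u ∧ MemLp u 2 (volume.restrict Ω) ∧
    MemLp (diffQuot s u) 2 (volume.restrict (crossSet Ω)) := by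
  unfold MemHs IntegrableOn
  refine and_congr_right fun hu => ?_
  rw [memLp_two_iff_integrable_sq hu.aestronglyMeasurable,
    memLp_two_iff_integrable_sq (measurable_diffQuot s hu).aestronglyMeasurable,
    show gagSq s u = fun p => diffQuot s u p ^ 2 from funext (gagSq_eq_diffQuot_sq s u)]

theorem MemHs.memLp (hu : MemHs s Ω u) : MemLp u 2 (volume.restrict Ω) := (memHs_iff.1 hu).2.1

theorem MemHs.memLp_diffQuot (hu : MemHs s Ω u) :
    MemLp (diffQuot s u) 2 (volume.restrict (crossSet Ω)) := (memHs_iff.1 hu).2.2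

theorem MemHs.sub (hu : MemHs s Ω u) (hv : MemHs s Ω v) : MemHs s Ω (u - v) :=
  memHs_iff.2 ⟨hu.1.sub hv.1, hu.memLp.sub hv.memLp,
    diffQuot_sub s u v ▸ hu.memLp_diffQuot.sub hv.memLp_diffQuot⟩

theorem MemHs.smul (hu : MemHs s Ω u) (t : ℝ) : MemHs s Ω (t • u) :=
  memHs_iff.2 ⟨hu.1.const_smul t, hu.memLp.const_smul t,
    diffQuot_smul s t u ▸ hu.memLp_diffQuot.const_smul t⟩

/-- A function in `H^s_{Ω,0}` as an element of `L²(Ω)`. -/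
def MemHs.l2 (hu : MemHs s Ω u) : Lp ℝ 2 (volume.restrict Ω) := hu.memLp.toLp u

/-- The difference quotient of a function in `H^s_{Ω,0}`, as a square-integrable function. -/
def MemHs.quot (hu : MemHs s Ω u) : Lp ℝ 2 (volume.restrict (crossSet Ω)) :=
  hu.memLp_diffQuot.toLp _

theorem MemHs.l2_sub (hu : MemHs s Ω u) (hv : MemHs s Ω v) (h : MemHs s Ω (u - v)) :
    h.l2 = hu.l2 - hv.l2 := MemLp.toLp_sub _ _

theorem MemHs.quot_sub (hu : MemHs s Ω u) (hv : MemHs s Ω v) (h : MemHs s Ω (u - v)) :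
    h.quot = hu.quot - hv.quot := by
  unfold MemHs.quot
  rw [← MemLp.toLp_sub]
  exact MemLp.toLp_congr _ _ (by rw [diffQuot_sub])

theorem MemHs.l2_smul (hu : MemHs s Ω u) (t : ℝ) : (hu.smul t).l2 = t • hu.l2 :=
  MemLp.toLp_const_smul _ _

theorem MemHs.quot_smul (hu : MemHs s Ω u) (t : ℝ) : (hu.smul t).quot = t • hu.quot := by
  unfold MemHs.quot
  rw [← MemLp.toLp_const_smul]
  exact MemLp.toLp_congr _ _ (by rw [diffQuot_smul])

theorem integral_gagSq (hu : MemHs s Ω u) :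
    ∫ p in crossSet Ω, gagSq s u p = ‖hu.quot‖ ^ 2 := by
  rw [MemHs.quot, norm_toLp_sq_eq_integral]
  simp_rw [gagSq_eq_diffQuot_sq]

theorem integral_gagBil (hu : MemHs s Ω u) (hv : MemHs s Ω v) :
    ∫ p in crossSet Ω, gagBil s u v p = inner ℝ hu.quot hv.quot := by
  rw [MemHs.quot, MemHs.quot, inner_toLp_eq_integral]
  simp_rw [gagBil_eq_diffQuot_mul]

theorem HsNorm_eq (hc : 0 ≤ c) (hu : MemHs s Ω u) :
    HsNorm c s Ω u = ‖hu.l2‖ + Real.sqrt (c / 2) * ‖hu.quot‖ := by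
  rw [HsNorm, seminormSq, integral_gagSq hu, ← Real.sqrt_eq_rpow, ← Real.sqrt_eq_rpow,
    Real.sqrt_mul (by positivity), Real.sqrt_sq (norm_nonneg _), MemHs.l2,
    ← norm_toLp_sq_eq_integral, Real.sqrt_sq (norm_nonneg _)]

theorem Eprime_eq {f : ℝ → ℝ} (hu : MemHs s Ω u)
    (hf : MemLp (fun x => f (u x)) 2 (volume.restrict Ω)) (hv : MemHs s Ω v) :
    Eprime c s Ω f u v = c / 2 * inner ℝ hu.quot hv.quot + inner ℝ hu.l2 hv.l2
      - inner ℝ (hf.toLp _) hv.l2 := by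
  rw [Eprime, integral_gagBil hu hv, MemHs.l2, MemHs.l2, inner_toLp_eq_integral,
    inner_toLp_eq_integral]

theorem energy_eq {f : ℝ → ℝ} (hu : MemHs s Ω u) :
    energy c s Ω f u = c / 4 * ‖hu.quot‖ ^ 2 + 1 / 2 * ‖hu.l2‖ ^ 2
      - ∫ x in Ω, (∫ τ in (0 : ℝ)..(u x), f τ) := by
  rw [energy, integral_gagSq hu, MemHs.l2, norm_toLp_sq_eq_integral]

/-- A bound for `E'(u)` on the unit ball extends to all of `H^s_{Ω,0}` by homogeneity. -/
theorem abs_Eprime_le {f : ℝ → ℝ} {η : ℝ} (hc : 0 ≤ c) (hu : MemHs s Ω u)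
    (hf : MemLp (fun x => f (u x)) 2 (volume.restrict Ω))
    (hη : ∀ v, MemHs s Ω v → HsNorm c s Ω v ≤ 1 → |Eprime c s Ω f u v| ≤ η)
    (hv : MemHs s Ω v) :
    |Eprime c s Ω f u v| ≤ η * (1 + ‖hv.l2‖ + Real.sqrt (c / 2) * ‖hv.quot‖) := by
  set N := 1 + ‖hv.l2‖ + Real.sqrt (c / 2) * ‖hv.quot‖ with hN
  have hNpos : 0 < N := by positivity
  have h := hη _ (hv.smul N⁻¹) ?_
  · rw [Eprime_eq hu hf (hv.smul _), hv.l2_smul, hv.quot_smul] at h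
    simp only [inner_smul_right] at h
    rw [show c / 2 * (N⁻¹ * inner ℝ hu.quot hv.quot) + N⁻¹ * inner ℝ hu.l2 hv.l2
        - N⁻¹ * inner ℝ (hf.toLp _) hv.l2 = N⁻¹ * Eprime c s Ω f u v by
          rw [Eprime_eq hu hf hv]; ring, abs_mul, abs_of_pos (inv_pos.2 hNpos),
      inv_mul_le_iff₀ hNpos, mul_comm] at h
    exact h
  · rw [HsNorm_eq hc (hv.smul _), hv.l2_smul, hv.quot_smul, norm_smul, norm_smul,
      Real.norm_of_nonneg (inv_nonneg.2 hNpos.le), mul_left_comm, ← mul_add,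
      inv_mul_le_iff₀ hNpos]
    linarith

/-- If `E'(u_k) → 0` in the dual norm and `u_k`, `f(u_k)` converge in `L²(Ω)`, then the difference
quotients of `u_k` are Cauchy. -/
theorem cauchySeq_quot_of_Eprime {f : ℝ → ℝ} (hc : 0 < c) {u : ℕ → En n → ℝ} {η : ℕ → ℝ}
    (hu : ∀ k, MemHs s Ω (u k)) (hf : ∀ k, MemLp (fun x => f (u k x)) 2 (volume.restrict Ω))
    (hη : Tendsto η atTop (𝓝 0))
    (hE : ∀ k v, MemHs s Ω v → HsNorm c s Ω v ≤ 1 → |Eprime c s Ω f (u k) v| ≤ η k)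
    (hl : CauchySeq fun k => (hu k).l2) (hfl : CauchySeq fun k => (hf k).toLp _) :
    CauchySeq fun k => (hu k).quot := by
  have hb : 0 < Real.sqrt (c / 2) := Real.sqrt_pos.2 (by positivity)
  refine cauchySeq_of_sq_norm_sub_le hl hfl hη hb fun k m => ?_
  have hv := (hu k).sub (hu m)
  have h1 := (le_abs_self _).trans (abs_Eprime_le hc.le (hu k) (hf k) (hE k) hv)
  have h2 := (neg_le_abs _).trans (abs_Eprime_le hc.le (hu m) (hf m) (hE m) hv)
  have h3 := real_inner_le_norm ((hf k).toLp _ - (hf m).toLp _) ((hu k).l2 - (hu m).l2)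
  have h4 := real_inner_self_eq_norm_sq ((hu k).quot - (hu m).quot)
  have h5 := real_inner_self_eq_norm_sq ((hu k).l2 - (hu m).l2)
  rw [Eprime_eq (hu k) (hf k) hv] at h1
  rw [Eprime_eq (hu m) (hf m) hv] at h2
  rw [(hu k).l2_sub (hu m) hv, (hu k).quot_sub (hu m) hv] at h1 h2
  rw [inner_sub_left] at h3 h4 h5
  rw [mul_pow, Real.sq_sqrt (by positivity)]
  nlinarith [sq_nonneg ‖(hu k).l2 - (hu m).l2‖]

/-- Membership in `H^s_{Ω,0}` passes to almost everywhere limits whose data converge in `L²`. -/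
theorem memHs_of_tendsto {u : ℕ → En n → ℝ} {u' : En n → ℝ}
    (hu' : Measurable u') (hlim : ∀ᵐ x, Tendsto (fun k => u k x) atTop (𝓝 (u' x)))
    (hl2 : MemLp u' 2 (volume.restrict Ω)) {W : Lp ℝ 2 (volume.restrict (crossSet Ω))}
    (hW : ∀ᵐ p ∂(volume.restrict (crossSet Ω)),
      Tendsto (fun k => diffQuot s (u k) p) atTop (𝓝 (W p))) :
    ∃ h : MemHs s Ω u', h.quot = W := by
  have hae : ∀ᵐ p ∂(volume.restrict (crossSet Ω)), W p = diffQuot s u' p := by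
    have h1 : ∀ᵐ p : En n × En n, Tendsto (fun k => u k p.1) atTop (𝓝 (u' p.1)) :=
      Measure.quasiMeasurePreserving_fst.ae hlim
    have h2 : ∀ᵐ p : En n × En n, Tendsto (fun k => u k p.2) atTop (𝓝 (u' p.2)) :=
      Measure.quasiMeasurePreserving_snd.ae hlim
    filter_upwards [hW, ae_restrict_of_ae h1, ae_restrict_of_ae h2] with p hp hp1 hp2
    exact tendsto_nhds_unique hp ((hp1.sub hp2).div_const _)
  have h : MemHs s Ω u' := memHs_iff.2 ⟨hu', hl2, (Lp.memLp W).ae_eq hae⟩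
  refine ⟨h, ?_⟩
  refine Lp.ext ?_
  filter_upwards [hae, h.memLp_diffQuot.coeFn_toLp] with p hp hq
  rw [MemHs.quot, hq, hp]

/-- If difference quotients converge almost everywhere on `crossSet Ω` and the functions converge
almost everywhere on `Ω`, then they converge almost everywhere on `ℝⁿ`. -/
theorem ae_exists_tendsto_of_diffQuot {u : ℕ → En n → ℝ} (hΩ : MeasurableSet Ω)
    (hΩpos : volume Ω ≠ 0)
    (hlim : ∀ᵐ x ∂(volume.restrict Ω), ∃ L, Tendsto (fun k => u k x) atTop (𝓝 L))
    {W : En n × En n → ℝ} (hW : ∀ᵐ p ∂(volume.restrict (crossSet Ω)),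
      Tendsto (fun k => diffQuot s (u k) p) atTop (𝓝 (W p))) :
    ∀ᵐ x, ∃ L, Tendsto (fun k => u k x) atTop (𝓝 L) := by
  have hcross : MeasurableSet (crossSet Ω) :=
    (measurable_fst hΩ).union (measurable_snd hΩ)
  rw [ae_restrict_iff' hcross, Measure.volume_eq_prod] at hW
  have hW := ae_restrict_of_ae (s := Ω) (Measure.ae_ae_of_ae_prod hW)
  have : (ae (volume.restrict Ω)).NeBot := by
    rw [ae_neBot]
    simpa using hΩpos
  obtain ⟨x, ⟨⟨L, hL⟩, hx⟩, hxΩ⟩ := ((hlim.and hW).and (ae_restrict_mem hΩ)).exists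
  filter_upwards [hx] with y hy
  have hy := hy (Or.inl hxΩ)
  by_cases hxy : x = y
  · exact ⟨L, hxy ▸ hL⟩
  · refine ⟨L - W (x, y) * dist x y ^ (((n : ℝ) + 2 * s) / 2),
      (hL.sub (hy.mul_const (dist x y ^ (((n : ℝ) + 2 * s) / 2)))).congr fun k => ?_⟩
    have : dist x y ^ (((n : ℝ) + 2 * s) / 2) ≠ 0 :=
      (Real.rpow_pos_of_pos (dist_pos.2 hxy) _).ne'
    simp only [diffQuot]
    rw [div_mul_cancel₀ _ this]
    ring

end FractionalSpace

/-! ### Sequences of radial monotone functions on the annulus -/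

section Annulus

variable {n : ℕ} {s R₀ R M : ℝ}

theorem nontrivial_En (hn : 1 ≤ n) : Nontrivial (En n) :=
  have : NeZero n := ⟨by omega⟩
  inferInstance

theorem ae_norm_notMem_of_countable (hn : 1 ≤ n) {C : Set ℝ} (hC : C.Countable) :
    ∀ᵐ x : En n, ‖x‖ ∉ C := by
  have := nontrivial_En hn
  have h := (ae_ball_iff hC (μ := (volume : Measure (En n)))
    (p := fun x r _ => ‖x‖ ≠ r)).2 fun r _ => by
      have h0 := Measure.addHaar_sphere (volume : Measure (En n)) 0 r
      filter_upwards [measure_eq_zero_iff_ae_notMem.1 h0] with x hx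
      simpa using hx
  filter_upwards [h] with x hx hxC
  exact hx _ hxC rfl

theorem norm_mem_Icc_of_mem_annR {x : En n} (hx : x ∈ annR n R₀ R) : ‖x‖ ∈ Icc R₀ R := by
  unfold annR at hx
  split_ifs at hx with h
  · exact ⟨h ▸ norm_nonneg x, (mem_ball_zero_iff.1 hx).le⟩
  · exact ⟨hx.1.le, hx.2.le⟩

theorem mem_annR_of_norm_mem_Ioo {x : En n} (hx : ‖x‖ ∈ Ioo R₀ R) : x ∈ annR n R₀ R := by
  unfold annR
  split_ifs with h
  · exact mem_ball_zero_iff.2 hx.2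
  · exact hx

theorem isOpen_annR (n : ℕ) (R₀ R : ℝ) : IsOpen (annR n R₀ R) := by
  unfold annR
  split_ifs
  · exact Metric.isOpen_ball
  · exact (isOpen_lt continuous_const continuous_norm).inter
      (isOpen_lt continuous_norm continuous_const)

theorem isFiniteMeasure_restrict_annR (n : ℕ) (R₀ R : ℝ) :
    IsFiniteMeasure (volume.restrict (annR n R₀ R)) := by
  refine ⟨?_⟩
  rw [Measure.restrict_apply_univ]
  refine (measure_mono fun x hx => ?_).trans_lt
    (measure_closedBall_lt_top (x := (0 : En n)) (r := R))
  exact mem_closedBall_zero_iff.2 (norm_mem_Icc_of_mem_annR hx).2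

theorem volume_annR_ne_zero (hn : 1 ≤ n) (hR₀ : 0 ≤ R₀) (hR : R₀ < R) :
    volume (annR n R₀ R) ≠ 0 := by
  have := nontrivial_En hn
  obtain ⟨x, hx⟩ := exists_norm_eq (En n) (c := (R₀ + R) / 2) (by linarith)
  exact ((isOpen_annR n R₀ R).measure_pos volume
    ⟨x, mem_annR_of_norm_mem_Ioo (by rw [hx]; constructor <;> linarith)⟩).ne'

/-- Bounded sequences in the cone `𝒞₊` converge almost everywhere in the annulus along a
subsequence. -/
theorem exists_subseq_ae_tendsto_of_inConePlus (hn : 1 ≤ n) (hR : R₀ < R) (hM : 0 ≤ M)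
    {u : ℕ → En n → ℝ} (hu : ∀ k, InConePlus s R₀ R (annR n R₀ R) (u k))
    (huM : ∀ k, ∀ᵐ x ∂(volume.restrict (annR n R₀ R)), u k x ≤ M) :
    ∃ σ : ℕ → ℕ, StrictMono σ ∧ ∀ᵐ x ∂(volume.restrict (annR n R₀ R)),
      ∃ L, Tendsto (fun k => u (σ k) x) atTop (𝓝 L) := by
  choose φ hφ hmono using fun k => (hu k).2.2
  let ψ : ℕ → ℝ → ℝ := fun k r => max 0 (min M (φ k (projIcc R₀ R hR.le r)))
  obtain ⟨σ, hσ, C, hC, hlim⟩ := exists_subseq_tendsto_of_monotone (M := M) ψ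
    (fun k r t hrt => max_le_max le_rfl (min_le_min le_rfl
      (hmono k (projIcc R₀ R hR.le r).2 (projIcc R₀ R hR.le t).2 (monotone_projIcc hR.le hrt))))
    (fun k r => ⟨le_max_left _ _, max_le hM (min_le_left _ _)⟩)
  refine ⟨σ, hσ, ?_⟩
  filter_upwards [ae_restrict_of_ae (ae_norm_notMem_of_countable hn hC), ae_all_iff.2 huM,
    ae_restrict_mem (isOpen_annR n R₀ R).measurableSet] with x hx hxM hxΩ
  obtain ⟨L, hL⟩ := hlim _ hx
  refine ⟨L, hL.congr fun k => ?_⟩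
  simp only [ψ, projIcc_of_mem hR.le (norm_mem_Icc_of_mem_annR hxΩ)]
  rw [← hφ, min_eq_right (hxM _), max_eq_right ((hu _).2.1 x)]

/-- The almost everywhere limit of a bounded sequence in `𝒞₊` has a representative that is
non-negative, radial and radially non-decreasing. -/
theorem exists_ae_limit_of_inConePlus (hn : 1 ≤ n) (hM : 0 ≤ M)
    {u : ℕ → En n → ℝ} (hu : ∀ k, InConePlus s R₀ R (annR n R₀ R) (u k))
    (huM : ∀ k, ∀ᵐ x ∂(volume.restrict (annR n R₀ R)), u k x ≤ M)
    (hlim : ∀ᵐ x, ∃ L, Tendsto (fun k => u k x) atTop (𝓝 L)) :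
    ∃ u' : En n → ℝ, Measurable u' ∧ (∀ x, 0 ≤ u' x) ∧
      (∃ φ, IsRadialWith u' φ ∧ MonotoneOn φ (Icc R₀ R)) ∧
      ∀ᵐ x, Tendsto (fun k => u k x) atTop (𝓝 (u' x)) := by
  classical
  choose φ hφ hmono using fun k => (hu k).2.2
  let T : ℝ → ℝ → ℝ := fun r t => if r ∈ Icc R₀ R then max 0 (min M t) else t
  let Φ : ℝ → ℝ := fun r => limsup (fun k => T r (φ k r)) atTop
  have hT0 : ∀ k (x : En n), 0 ≤ T ‖x‖ (φ k ‖x‖) := by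
    intro k x
    simp only [T]
    split_ifs
    · exact le_max_left _ _
    · exact hφ k x ▸ (hu k).2.1 x
  have hmeas : Measurable fun x : En n => Φ ‖x‖ := by
    refine Measurable.limsup fun k => ?_
    simp only [T, ← hφ k _]
    refine Measurable.ite (measurable_norm measurableSet_Icc) ?_ (hu k).1.1
    exact measurable_const.max (measurable_const.min (hu k).1.1)
  refine ⟨fun x => Φ ‖x‖, hmeas, fun x => ?_, ⟨Φ, fun _ => rfl, ?_⟩, ?_⟩
  · refine Real.sInf_nonneg fun a ha => ?_
    obtain ⟨k, hk⟩ := Eventually.exists (Filter.eventually_map.1 ha)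
    exact (hT0 k x).trans hk
  · intro r hr t ht hrt
    have hb0 : ∀ k, 0 ≤ T r (φ k r) := fun k => by simp only [T, if_pos hr]; exact le_max_left _ _
    have hbM : ∀ k, T t (φ k t) ≤ M := fun k => by
      simp only [T, if_pos ht]; exact max_le hM (min_le_left _ _)
    refine limsup_le_limsup (Eventually.of_forall fun k => ?_)
      (isBoundedUnder_of ⟨0, hb0⟩ : IsBoundedUnder (· ≥ ·) atTop _).isCoboundedUnder_le
      (isBoundedUnder_of ⟨M, hbM⟩)
    simp only [T, if_pos hr, if_pos ht]
    exact max_le_max le_rfl (min_le_min le_rfl (hmono k hr ht hrt))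
  · have hM' : ∀ᵐ x : En n, ∀ k, x ∈ annR n R₀ R → u k x ≤ M := ae_all_iff.2 fun k =>
      (ae_restrict_iff' (isOpen_annR n R₀ R).measurableSet).1 (huM k)
    filter_upwards [hlim, hM', ae_norm_notMem_of_countable hn
      ((countable_singleton R).insert R₀)] with x ⟨L, hL⟩ hxM hxR
    simp only [mem_insert_iff, mem_singleton_iff, not_or] at hxR
    have hTu : ∀ k, T ‖x‖ (φ k ‖x‖) = u k x := by
      intro k
      simp only [T, ← hφ k x]
      split_ifs with h
      · have hxΩ : x ∈ annR n R₀ R := mem_annR_of_norm_mem_Ioo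
          ⟨lt_of_le_of_ne h.1 (Ne.symm hxR.1), lt_of_le_of_ne h.2 hxR.2⟩
        rw [min_eq_right (hxM k hxΩ), max_eq_right ((hu k).2.1 x)]
      · rfl
    have : Φ ‖x‖ = L := by
      simp only [Φ, hTu]
      exact hL.limsup_eq
    simpa only [this] using hL

/-- Compactness of almost critical sequences in the order interval of `𝒞₊`: a subsequence converges
almost everywhere, together with its difference quotients in `L²`, to an element of `𝒞₊`. -/
theorem exists_limit_of_Eprime_tendsto_zero {c : ℝ} (hn : 1 ≤ n) (hR₀ : 0 ≤ R₀) (hR : R₀ < R)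
    (hc : 0 < c) (hM : 0 ≤ M) {f : ℝ → ℝ} (hf : Continuous f) {u : ℕ → En n → ℝ}
    (hu : ∀ k, InConePlus s R₀ R (annR n R₀ R) (u k))
    (huM : ∀ k, ∀ᵐ x ∂(volume.restrict (annR n R₀ R)), u k x ≤ M)
    {η : ℕ → ℝ} (hη : Tendsto η atTop (𝓝 0))
    (hE : ∀ k v, MemHs s (annR n R₀ R) v → HsNorm c s (annR n R₀ R) v ≤ 1 →
      |Eprime c s (annR n R₀ R) f (u k) v| ≤ η k) :
    ∃ σ : ℕ → ℕ, StrictMono σ ∧ ∃ u', ∃ hu' : InConePlus s R₀ R (annR n R₀ R) u',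
      (∀ᵐ x, Tendsto (fun k => u (σ k) x) atTop (𝓝 (u' x))) ∧
      Tendsto (fun k => (hu (σ k)).1.quot) atTop (𝓝 hu'.1.quot) := by
  have := isFiniteMeasure_restrict_annR n R₀ R
  have hΩ := (isOpen_annR n R₀ R).measurableSet
  have huI : ∀ k, ∀ᵐ x ∂(volume.restrict (annR n R₀ R)), u k x ∈ Icc 0 M := fun k =>
    (huM k).mono fun x hx => ⟨(hu k).2.1 x, hx⟩
  obtain ⟨σ, hσ, hlim⟩ := exists_subseq_ae_tendsto_of_inConePlus hn hR hM hu huM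
  obtain ⟨u₀, hu₀, hlim₀⟩ := measurable_limit_of_tendsto_metrizable_ae
    (fun k => (hu (σ k)).1.1.aemeasurable) hlim
  have hu₀I : ∀ᵐ x ∂(volume.restrict (annR n R₀ R)), u₀ x ∈ Icc 0 M := by
    filter_upwards [hlim₀, ae_all_iff.2 huI] with x hx hxI
    exact isClosed_Icc.mem_of_tendsto hx (Eventually.of_forall fun k => hxI _)
  have hfk : ∀ k, MemLp (fun x => f (u k x)) 2 (volume.restrict (annR n R₀ R)) := fun k =>
    memLp_comp_of_mem_Icc hf (hu k).1.1 (huI k)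
  have hl := tendsto_toLp_comp_of_mem_Icc continuous_id (fun k => huI (σ k)) hlim₀
    (fun k => (hu (σ k)).1.memLp) (memLp_comp_of_mem_Icc continuous_id hu₀ hu₀I)
  have hfl := tendsto_toLp_comp_of_mem_Icc hf (fun k => huI (σ k)) hlim₀
    (fun k => hfk (σ k)) (memLp_comp_of_mem_Icc hf hu₀ hu₀I)
  obtain ⟨W, hW⟩ := cauchySeq_tendsto_of_complete (cauchySeq_quot_of_Eprime hc
    (fun k => (hu (σ k)).1) (fun k => hfk (σ k)) (hη.comp hσ.tendsto_atTop)
    (fun k => hE (σ k)) hl.cauchySeq hfl.cauchySeq)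
  obtain ⟨τ, hτ, hτW⟩ := (tendstoInMeasure_of_tendsto_Lp hW).exists_seq_tendsto_ae
  have hquot : ∀ᵐ p ∂(volume.restrict (crossSet (annR n R₀ R))),
      Tendsto (fun k => diffQuot s (u (σ (τ k))) p) atTop (𝓝 (W p)) := by
    filter_upwards [hτW, ae_all_iff.2 fun k => (hu (σ (τ k))).1.memLp_diffQuot.coeFn_toLp]
      with p hp hpk
    exact hp.congr fun k => hpk k
  obtain ⟨u', hu'meas, hu'0, hu'rad, hu'lim⟩ := exists_ae_limit_of_inConePlus hn hM
    (fun k => hu (σ (τ k))) (fun k => huM (σ (τ k)))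
    (ae_exists_tendsto_of_diffQuot hΩ (volume_annR_ne_zero hn hR₀ hR)
      (hlim.mono fun x ⟨L, hL⟩ => ⟨L, hL.comp hτ.tendsto_atTop⟩) hquot)
  have hu'I : ∀ᵐ x ∂(volume.restrict (annR n R₀ R)), u' x ∈ Icc 0 M := by
    filter_upwards [ae_restrict_of_ae hu'lim, ae_all_iff.2 huI] with x hx hxI
    exact isClosed_Icc.mem_of_tendsto hx (Eventually.of_forall fun k => hxI _)
  obtain ⟨hmem, hWeq⟩ := memHs_of_tendsto hu'meas hu'lim
    (memLp_comp_of_mem_Icc continuous_id hu'meas hu'I) hquot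
  exact ⟨σ ∘ τ, hσ.comp hτ, u', ⟨hmem, hu'0, hu'rad⟩, hu'lim,
    hWeq ▸ hW.comp hτ.tendsto_atTop⟩

end Annulus

/-- If no element of the order interval of `𝒞₊` at energy level `clevel` is critical, then `E'` is
bounded away from zero on it near that level; version for a continuous nonlinearity. -/
theorem exists_pos_Eprime_lower_bound {n : ℕ} {s c R₀ R um up clevel : ℝ} (hn : 1 ≤ n)
    (hc : 0 < c) (hR₀ : 0 ≤ R₀) (hR : R₀ < R) (hup : 0 ≤ up) {f : ℝ → ℝ} (hf : Continuous f)
    (hcrit : ∀ u : En n → ℝ, InConePlus s R₀ R (annR n R₀ R) u →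
      (∀ᵐ x ∂(volume.restrict (annR n R₀ R)), um ≤ u x ∧ u x ≤ up) →
      energy c s (annR n R₀ R) f u = clevel →
      ∃ v : En n → ℝ, MemHs s (annR n R₀ R) v ∧ Eprime c s (annR n R₀ R) f u v ≠ 0) :
    ∃ δ > (0 : ℝ), ∀ u : En n → ℝ, InConePlus s R₀ R (annR n R₀ R) u →
      (∀ᵐ x ∂(volume.restrict (annR n R₀ R)), um ≤ u x ∧ u x ≤ up) →
      |energy c s (annR n R₀ R) f u - clevel| ≤ 2 * δ →
      ∀ ε > (0 : ℝ), ∃ v : En n → ℝ, MemHs s (annR n R₀ R) v ∧ HsNorm c s (annR n R₀ R) v ≤ 1 ∧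
        δ - ε ≤ |Eprime c s (annR n R₀ R) f u v| := by
  by_contra! hcon
  choose u hu hub huE ε hε huv using fun k : ℕ => hcon (1 / ((k : ℝ) + 1)) (by positivity)
  have hη : Tendsto (fun k : ℕ => 1 / ((k : ℝ) + 1)) atTop (𝓝 0) :=
    tendsto_one_div_add_atTop_nhds_zero_nat
  have hE : ∀ k v, MemHs s (annR n R₀ R) v → HsNorm c s (annR n R₀ R) v ≤ 1 →
      |Eprime c s (annR n R₀ R) f (u k) v| ≤ 1 / ((k : ℝ) + 1) := fun k v hv hv1 => by
    linarith [huv k v hv hv1, hε k]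
  obtain ⟨σ, hσ, u', hu', hlim, hquot⟩ := exists_limit_of_Eprime_tendsto_zero hn hR₀ hR hc hup hf
    hu (fun k => (hub k).mono fun x hx => hx.2) hη hE
  have := isFiniteMeasure_restrict_annR n R₀ R
  have hησ := hη.comp hσ.tendsto_atTop
  have huI : ∀ k, ∀ᵐ x ∂(volume.restrict (annR n R₀ R)), u (σ k) x ∈ Icc 0 up := fun k =>
    (hub _).mono fun x hx => ⟨(hu _).2.1 x, hx.2⟩
  have hlimΩ := ae_restrict_of_ae (s := annR n R₀ R) hlim
  have hub' : ∀ᵐ x ∂(volume.restrict (annR n R₀ R)), um ≤ u' x ∧ u' x ≤ up := by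
    filter_upwards [hlimΩ, ae_all_iff.2 hub] with x hx hxI
    exact isClosed_Icc.mem_of_tendsto hx (Eventually.of_forall fun k => hxI _)
  have hfk := fun k => memLp_comp_of_mem_Icc hf (hu (σ k)).1.1 (huI k)
  have hf' := memLp_comp_of_mem_Icc hf hu'.1.1 (hub'.mono fun x hx => ⟨hu'.2.1 x, hx.2⟩)
  have hl2 : Tendsto (fun k => (hu (σ k)).1.l2) atTop (𝓝 hu'.1.l2) :=
    tendsto_toLp_comp_of_mem_Icc continuous_id huI hlimΩ (fun k => (hu (σ k)).1.memLp)
      hu'.1.memLp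
  have hfl2 := tendsto_toLp_comp_of_mem_Icc hf huI hlimΩ hfk hf'
  have hlevel : energy c s (annR n R₀ R) f u' = clevel := by
    have h1 : Tendsto (fun k => energy c s (annR n R₀ R) f (u (σ k))) atTop
        (𝓝 (energy c s (annR n R₀ R) f u')) := by
      rw [energy_eq hu'.1]
      simp_rw [fun k => energy_eq (c := c) (f := f) (hu (σ k)).1]
      have hF : Continuous fun t => ∫ τ in (0 : ℝ)..t, f τ :=
        intervalIntegral.continuous_primitive (fun a b => hf.intervalIntegrable a b) 0
      exact (((hquot.norm.pow 2).const_mul _).add ((hl2.norm.pow 2).const_mul _)).sub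
        (tendsto_integral_comp_of_mem_Icc hF (fun k => (hu (σ k)).1.1) huI hlimΩ)
    refine tendsto_nhds_unique h1 (tendsto_iff_norm_sub_tendsto_zero.2 ?_)
    refine squeeze_zero (fun _ => norm_nonneg _) (fun k => huE (σ k)) ?_
    simpa using hησ.const_mul 2
  obtain ⟨v, hv, hne⟩ := hcrit u' hu' hub' hlevel
  refine hne (tendsto_nhds_unique (f := fun k => Eprime c s (annR n R₀ R) f (u (σ k)) v)
    (l := atTop) ?_ ?_)
  · rw [Eprime_eq hu'.1 hf' hv]
    simp_rw [fun k => Eprime_eq (c := c) (hu (σ k)).1 (hfk k) hv]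
    exact (((hquot.inner tendsto_const_nhds).const_mul _).add
      (hl2.inner tendsto_const_nhds)).sub (hfl2.inner tendsto_const_nhds)
  · refine squeeze_zero_norm
      (fun k => abs_Eprime_le hc.le (hu (σ k)).1 (hfk k) (hE (σ k)) hv) ?_
    simpa using hησ.mul_const (1 + ‖hv.l2‖ + Real.sqrt (c / 2) * ‖hv.quot‖)

theorem energy_congr_of_nonneg {n : ℕ} {c s : ℝ} {Ω : Set (En n)} {f g : ℝ → ℝ}
    (hfg : ∀ t, 0 ≤ t → f t = g t) {u : En n → ℝ} (hu : ∀ x, 0 ≤ u x) :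
    energy c s Ω f u = energy c s Ω g u := by
  have h : ∀ x, ∫ τ in (0 : ℝ)..(u x), f τ = ∫ τ in (0 : ℝ)..(u x), g τ := fun x =>
    intervalIntegral.integral_congr fun t ht => hfg t (by rw [uIcc_of_le (hu x)] at ht; exact ht.1)
  simp only [energy, h]

theorem Eprime_congr_of_nonneg {n : ℕ} {c s : ℝ} {Ω : Set (En n)} {f g : ℝ → ℝ}
    (hfg : ∀ t, 0 ≤ t → f t = g t) {u : En n → ℝ} (hu : ∀ x, 0 ≤ u x) (v : En n → ℝ) :
    Eprime c s Ω f u v = Eprime c s Ω g u v := by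
  simp only [Eprime, hfg _ (hu _)]

/-- uniform lower bound on `‖E'(u)‖_*` near a non-critical level `c` in the
restricted cone `𝒞_*`. -/
theorem statement13 {n : ℕ} (hn : 1 ≤ n) {s c R₀ R ℓ C₀ um up : ℝ}
    (hs : s ∈ Ioo (1/2 : ℝ) 1) (hc : 0 < c) (hR₀ : 0 ≤ R₀) (hR : R₀ < R)
    (hℓ : 2 < ℓ) (hℓsub : 2 * s < n → ℓ < 2 * n / ((n:ℝ) - 2 * s))
    (Ω : Set (En n)) (hΩ : Ω = annR n R₀ R)
    (ftil : ℝ → ℝ) (hC₀ : 0 < C₀)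
    (hdiff : ContDiffOn ℝ 1 ftil (Ici 0))
    (hzero : ∀ t < (0:ℝ), ftil t = 0)
    (hnonneg : ∀ t, 0 ≤ ftil t)
    (hlim : Tendsto (fun t => ftil t / t ^ (ℓ - 1)) atTop (nhds 1))
    (hgrowth : ∀ t ≥ (0:ℝ), ftil t ≤ C₀ * (1 + t ^ (ℓ - 1)))
    (hum : 0 ≤ um) (hump : um < up)
    (clevel : ℝ)
    (hcrit : ∀ u : En n → ℝ, InConePlus s R₀ R Ω u →
      (∀ᵐ x ∂(volume.restrict Ω), um ≤ u x ∧ u x ≤ up) →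
      energy c s Ω ftil u = clevel →
      ∃ v : En n → ℝ, MemHs s Ω v ∧ Eprime c s Ω ftil u v ≠ 0) :
    ∃ εb > (0:ℝ), ∃ δb > (0:ℝ), ∀ u : En n → ℝ,
      InConePlus s R₀ R Ω u →
      (∀ᵐ x ∂(volume.restrict Ω), um ≤ u x ∧ u x ≤ up) →
      |energy c s Ω ftil u - clevel| ≤ 2 * εb →
      ∀ ε > (0:ℝ), ∃ v : En n → ℝ, MemHs s Ω v ∧ HsNorm c s Ω v ≤ 1 ∧
        δb - ε ≤ |Eprime c s Ω ftil u v| := by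
  subst hΩ
  have hg : Continuous fun t => ftil (max 0 t) :=
    hdiff.continuousOn.comp_continuous (continuous_const.max continuous_id) fun t =>
      le_max_left 0 t
  have hfg : ∀ t, 0 ≤ t → ftil t = ftil (max 0 t) := fun t ht => by rw [max_eq_right ht]
  obtain ⟨δ, hδ, h⟩ := exists_pos_Eprime_lower_bound hn hc hR₀ hR (hum.trans hump.le) hg
    fun u hu hub hE => by
      rw [← energy_congr_of_nonneg hfg hu.2.1] at hE
      obtain ⟨v, hv, hne⟩ := hcrit u hu hub hE
      exact ⟨v, hv, Eprime_congr_of_nonneg hfg hu.2.1 v ▸ hne⟩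
  refine ⟨δ, hδ, δ, hδ, fun u hu hub hE ε hε => ?_⟩
  rw [energy_congr_of_nonneg hfg hu.2.1] at hE
  obtain ⟨v, hv, hv1, hle⟩ := h u hu hub hE ε hε
  exact ⟨v, hv, hv1, Eprime_congr_of_nonneg hfg hu.2.1 v ▸ hle⟩

end
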